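/- arXiv:2501.13935 — 7 statements merged into one kernel-verified Lean document; each statement's English description precedes it below -/
import Mathlib

section
/- For every n ≥ 1 and every matrix M ∈ Z₂^{n×n}, there exists a diagonal matrix D ∈ Z₂^{n×n} such that the matrix M + D is degenerate (i.e., det(M + D) = 0). -/
/-- Over `ZMod 2`, the determinants of all diagonal perturbations of a matrix sum to `1`: the sum
extracts the coefficient of `∏ i, d i` in the multilinear polynomial `det (M + diagonal d)`. -/
theorem sum_det_add_diagonal_zmod_two {ι : Type*} [Fintype ι] [DecidableEq ι]
    (M : Matrix ι ι (ZMod 2)) :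
    ∑ d : ι → ZMod 2, (M + Matrix.diagonal d).det = 1 := by
  have entry (σ : Equiv.Perm ι) (i : ι) :
      ∑ x : ZMod 2, (M (σ i) i + if σ i = i then x else 0) = if σ i = i then 1 else 0 := by
    generalize M (σ i) i = a
    split_ifs <;> revert a <;> decide
  have term (σ : Equiv.Perm ι) :
      ∑ d : ι → ZMod 2, ∏ i, (M + Matrix.diagonal d) (σ i) i = if σ = 1 then 1 else 0 := by
    have h (d : ι → ZMod 2) (i : ι) : (M + Matrix.diagonal d) (σ i) i =
        M (σ i) i + if σ i = i then d i else 0 := by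
      by_cases hi : σ i = i <;> simp [hi]
    simp_rw [h]
    rw [← Fintype.prod_sum fun i (x : ZMod 2) ↦ M (σ i) i + if σ i = i then x else 0]
    simp_rw [entry, Finset.prod_ite_zero, Finset.prod_const_one]
    exact if_congr (by simp [Equiv.Perm.ext_iff]) rfl rfl
  simp_rw [Matrix.det_apply]
  rw [Finset.sum_comm]
  simp_rw [← Finset.smul_sum, term]
  simp

/-- For every `n ≥ 1` and every matrix `M ∈ Z₂^{n×n}`, there exists a
diagonal matrix `D ∈ Z₂^{n×n}` such that `M + D` is degenerate, i.e. `det (M + D) = 0`. -/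
theorem exists_diagonal_add_degenerate (n : ℕ) (hn : 1 ≤ n)
    (M : Matrix (Fin n) (Fin n) (ZMod 2)) :
    ∃ D : Matrix (Fin n) (Fin n) (ZMod 2), D.IsDiag ∧ (M + D).det = 0 := by
  by_contra! h
  have eq_one (d : Fin n → ZMod 2) : (M + Matrix.diagonal d).det = 1 :=
    Fin.eq_one_of_ne_zero _ (h _ (Matrix.isDiag_diagonal d))
  have hsum := sum_det_add_diagonal_zmod_two M
  have two_eq_zero : (2 : ZMod 2) = 0 := rfl
  simp [eq_one, two_eq_zero, Nat.one_le_iff_ne_zero.mp hn] at hsum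
end

section
/- For every n and every matrix M ∈ Z₂^{n×n}, there exists a diagonal matrix D ∈ Z₂^{n×n} such that the matrix M + D is non-degenerate (i.e., det(M + D) = 1). -/
/-- Over a commutative ring, every square matrix acquires determinant `1` after a suitable change
of its diagonal. -/
theorem exists_det_add_diagonal_eq_one {R : Type*} [CommRing R] {n : ℕ}
    (M : Matrix (Fin n) (Fin n) R) :
    ∃ d : Fin n → R, (M + Matrix.diagonal d).det = 1 := by
  induction n with
  | zero => exact ⟨0, Matrix.det_fin_zero⟩
  | succ n ih =>
    obtain ⟨d, hd⟩ := ih (M.submatrix Fin.succ Fin.succ)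
    have minor_eq (c : R) (j : Fin (n + 1)) :
        (M + Matrix.diagonal (Fin.cons c d : Fin (n + 1) → R)).submatrix Fin.succ j.succAbove =
          (M + Matrix.diagonal (Fin.cons 0 d : Fin (n + 1) → R)).submatrix
            Fin.succ j.succAbove := by
      ext i k
      simp [Matrix.diagonal_apply]
    have minor_zero (c : R) :
        (M + Matrix.diagonal (Fin.cons c d : Fin (n + 1) → R)).submatrix Fin.succ Fin.succ =
          M.submatrix Fin.succ Fin.succ + Matrix.diagonal d := by
      ext i k
      simp [Matrix.diagonal_apply]
    have det_eq (c : R) : (M + Matrix.diagonal (Fin.cons c d : Fin (n + 1) → R)).det =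
        c + (M + Matrix.diagonal (Fin.cons 0 d : Fin (n + 1) → R)).det := by
      rw [Matrix.det_succ_row_zero, Matrix.det_succ_row_zero, Fin.sum_univ_succ,
        Fin.sum_univ_succ]
      simp only [minor_eq c, Fin.succAbove_zero, minor_zero, hd, Matrix.add_apply,
        Matrix.diagonal_apply, Fin.cons_zero, (Fin.succ_ne_zero _).symm, if_true, if_false,
        Fin.val_zero, pow_zero]
      ring
    exact ⟨Fin.cons (1 - (M + Matrix.diagonal (Fin.cons 0 d : Fin (n + 1) → R)).det) d, by
      rw [det_eq, sub_add_cancel]⟩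

/-- For every `n` and every matrix `M ∈ Z₂^{n×n}`, there exists a
diagonal matrix `D ∈ Z₂^{n×n}` such that `M + D` is non-degenerate, i.e. `det (M + D) = 1`. -/
theorem exists_diagonal_add_nondegenerate (n : ℕ)
    (M : Matrix (Fin n) (Fin n) (ZMod 2)) :
    ∃ D : Matrix (Fin n) (Fin n) (ZMod 2), D.IsDiag ∧ (M + D).det = 1 := by
  obtain ⟨d, hd⟩ := exists_det_add_diagonal_eq_one M
  exact ⟨Matrix.diagonal d, Matrix.isDiag_diagonal d, hd⟩
end

section
/- For every non-degenerate matrix M ∈ Z₂^{n×n} and every diagonal matrix D ∈ Z₂^{n×n}, one has 2·rank(M + D) ≥ rank(M + E), where E ∈ Z₂^{n×n} is the identity matrix. -/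
/-- The rank of matrices over a field is subadditive. -/
theorem matrix_rank_add_le {m n K : Type*} [Fintype m] [Fintype n] [Field K]
    (A B : Matrix m n K) : (A + B).rank ≤ A.rank + B.rank := by
  unfold Matrix.rank
  rw [Matrix.mulVecLin_add]
  exact (Submodule.finrank_mono (LinearMap.range_add_le _ _)).trans
    (Submodule.finrank_add_le_finrank_add_finrank _ _)

/-- Over `ZMod 2`, the ranks of complementary diagonal matrices add up to the size. -/
theorem rank_diagonal_add_rank_one_add_diagonal {n : ℕ} (d : Fin n → ZMod 2) :
    (Matrix.diagonal d).rank + (1 + Matrix.diagonal d).rank = n := by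
  have h : ∀ x : ZMod 2, 1 + x ≠ 0 ↔ x = 0 := by decide
  rw [← Matrix.diagonal_one, Matrix.diagonal_add, Matrix.rank_diagonal, Matrix.rank_diagonal,
    Fintype.card_subtype, Fintype.card_subtype]
  simp only [h]
  rw [add_comm, Finset.card_filter_add_card_filter_not, Finset.card_univ, Fintype.card_fin]

/-- For every non-degenerate matrix `M ∈ Z₂^{n×n}` and every diagonal
matrix `D ∈ Z₂^{n×n}`, one has `2 · rank (M + D) ≥ rank (M + E)`, where `E` is the
identity matrix. -/
theorem two_mul_rank_add_diag_ge (n : ℕ)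
    (M : Matrix (Fin n) (Fin n) (ZMod 2)) (hM : M.det ≠ 0)
    (D : Matrix (Fin n) (Fin n) (ZMod 2)) (hD : D.IsDiag) :
    (M + 1).rank ≤ 2 * (M + D).rank := by
  obtain ⟨d, rfl⟩ : ∃ d, D = Matrix.diagonal d := ⟨D.diag, hD.diagonal_diag.symm⟩
  set D := Matrix.diagonal d
  have hDD : D + D = 0 := by
    ext i j
    exact CharTwo.add_self_eq_zero _
  have hM_rank : M.rank = n := by
    simpa using Matrix.rank_of_isUnit M ((Matrix.isUnit_iff_isUnit_det M).2 hM.isUnit)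
  have h₁ : M.rank ≤ (M + D).rank + D.rank := by
    simpa [add_assoc, hDD] using matrix_rank_add_le (M + D) D
  have h₂ : (M + 1).rank ≤ (M + D).rank + (1 + D).rank := by
    have h : M + 1 = (M + D) + (1 + D) := by
      rw [add_add_add_comm, hDD, add_zero]
    rw [h]
    exact matrix_rank_add_le _ _
  have h₃ : D.rank + (1 + D).rank = n := rank_diagonal_add_rank_one_add_diagonal d
  omega
end

section
/- Let M ∈ Z₂^{n×n} and let D₀ ∈ Z₂^{n×n} be any diagonal matrix such that M + D₀ is non-degenerate. Set k := rank(M + D₀ + E), where E is the identity matrix. Then k/2 ≤ R(M) ≤ k, i.e., for every diagonal matrix D one has 2·rank(M + D) ≥ k, and there exists a diagonal matrix D with rank(M + D) ≤ k. -/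
/-- The rank of matrices over a field is subadditive. -/
theorem Matrix.rank_add_le_rank_add_rank {m n K : Type*} [Fintype n] [Finite m] [Field K]
    (A B : Matrix m n K) : (A + B).rank ≤ A.rank + B.rank := by
  have h : LinearMap.range (A + B).mulVecLin ≤
      LinearMap.range A.mulVecLin ⊔ LinearMap.range B.mulVecLin := by
    rw [Matrix.mulVecLin_add]
    rintro _ ⟨x, rfl⟩
    exact Submodule.add_mem_sup ⟨x, rfl⟩ ⟨x, rfl⟩
  exact (Submodule.finrank_mono h).trans (Submodule.finrank_add_le_finrank_add_finrank _ _)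

/-- Let `M ∈ Z₂^{n×n}` and let `D₀` be any diagonal matrix such that
`M + D₀` is non-degenerate. Set `k := rank (M + D₀ + E)`. Then `k/2 ≤ R(M) ≤ k`:
for every diagonal matrix `D` one has `2 · rank (M + D) ≥ k`, and there exists a
diagonal matrix `D` with `rank (M + D) ≤ k`. -/
theorem rank_min_diag_bounds (n : ℕ)
    (M D₀ : Matrix (Fin n) (Fin n) (ZMod 2)) (hD₀ : D₀.IsDiag)
    (hnd : (M + D₀).det ≠ 0) (k : ℕ) (hk : k = (M + D₀ + 1).rank) :
    (∀ D : Matrix (Fin n) (Fin n) (ZMod 2), D.IsDiag → k ≤ 2 * (M + D).rank) ∧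
    (∃ D : Matrix (Fin n) (Fin n) (ZMod 2), D.IsDiag ∧ (M + D).rank ≤ k) := by
  refine ⟨fun D hD => ?_, D₀ + 1, hD₀.add Matrix.isDiag_one, by rw [hk, add_assoc]⟩
  have double_eq_zero (X : Matrix (Fin n) (Fin n) (ZMod 2)) : X + X = 0 := by
    ext i j
    exact CharTwo.add_self_eq_zero _
  have projection : (D + D₀) * (D + D₀ + 1) = 0 := by
    obtain ⟨d, hd⟩ : ∃ d, Matrix.diagonal d = D + D₀ := ⟨_, (hD.add hD₀).diagonal_diag⟩
    rw [← hd, ← Matrix.diagonal_one, Matrix.diagonal_add, Matrix.diagonal_mul_diagonal,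
      ← Matrix.diagonal_zero]
    congr 1
    funext i
    have idem : ∀ x : ZMod 2, x * (x + 1) = 0 := by decide
    exact idem (d i)
  have rank_complement := Matrix.rank_add_rank_le_card_of_mul_eq_zero projection
  have rank_full : (M + D₀).rank = n := by
    rw [Matrix.rank_of_isUnit _ ((Matrix.isUnit_iff_isUnit_det _).2 hnd.isUnit), Fintype.card_fin]
  have split_nondegenerate : M + D₀ = (M + D) + (D + D₀) := by
    rw [← add_assoc, add_assoc M D D, double_eq_zero, add_zero]
  have split_shifted : M + D₀ + 1 = (M + D) + (D + D₀ + 1) := by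
    rw [split_nondegenerate, add_assoc]
  have bound_full := Matrix.rank_add_le_rank_add_rank (M + D) (D + D₀)
  have bound_shifted := Matrix.rank_add_le_rank_add_rank (M + D) (D + D₀ + 1)
  rw [← split_nondegenerate, rank_full] at bound_full
  rw [← split_shifted, ← hk] at bound_shifted
  rw [Fintype.card_fin] at rank_complement
  omega
end

section
/- Let M ∈ Z₂^{n×n} be a matrix all of whose diagonal entries are zero. Define a sequence of matrices M^{(0)}, M^{(1)}, …, M^{(n)} recursively: M^{(0)} := M, and M^{(i)} is obtained from M^{(i−1)} by replacing the entry M^{(i−1)}_{i,i} = 0 by 1 + δ_i, where δ_i is the determinant of the upper-left i×i corner submatrix of M^{(i−1)}. Then the matrix M^{(n)} is non-degenerate (det M^{(n)} = 1). -/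
/-- Changing only the bottom-right entry of a square matrix changes the determinant by the
difference of the entries times the leading principal minor. -/
theorem det_eq_add_mul_det_of_eq_off_last {R : Type*} [CommRing R] {k : ℕ}
    (A B : Matrix (Fin (k + 1)) (Fin (k + 1)) R)
    (h : ∀ a b, ¬(a = Fin.last k ∧ b = Fin.last k) → B a b = A a b) :
    B.det = A.det + (B (Fin.last k) (Fin.last k) - A (Fin.last k) (Fin.last k)) *
      (A.submatrix Fin.castSucc Fin.castSucc).det := by
  have hsub (j : Fin (k + 1)) : B.submatrix (Fin.last k).succAbove j.succAbove =
      A.submatrix (Fin.last k).succAbove j.succAbove := by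
    ext a b
    exact h _ _ fun hab => Fin.succAbove_ne _ _ hab.1
  have hrow (j : Fin k) : B (Fin.last k) j.castSucc = A (Fin.last k) j.castSucc :=
    h _ _ fun hab => (Fin.castSucc_lt_last j).ne hab.2
  rw [Matrix.det_succ_row B (Fin.last k), Matrix.det_succ_row A (Fin.last k),
    Fin.sum_univ_castSucc, Fin.sum_univ_castSucc]
  simp only [hsub, hrow]
  simp only [Fin.val_last, Even.neg_one_pow (Even.add_self k), Fin.succAbove_last]
  ring

/-- Let `M ∈ Z₂^{n×n}` have all diagonal entries zero. Define
`M⁽⁰⁾ := M`, and for `1 ≤ i ≤ n` let `M⁽ⁱ⁾` be obtained from `M⁽ⁱ⁻¹⁾` by replacing the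
entry at position `(i,i)` (1-indexed) by `1 + δᵢ`, where `δᵢ` is the determinant of the
upper-left `i×i` corner submatrix of `M⁽ⁱ⁻¹⁾`. Then `M⁽ⁿ⁾` is non-degenerate:
`det M⁽ⁿ⁾ = 1`. -/
theorem det_recursive_diagonal_fix (n : ℕ)
    (M : Matrix (Fin n) (Fin n) (ZMod 2)) (hdiag : ∀ i, M i i = 0)
    (Ms : ℕ → Matrix (Fin n) (Fin n) (ZMod 2))
    (h0 : Ms 0 = M)
    (hstep : ∀ i : ℕ, 1 ≤ i → ∀ h2 : i ≤ n, ∀ a b : Fin n,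
      Ms i a b =
        if a.val = i - 1 ∧ b.val = i - 1 then
          1 + ((Ms (i - 1)).submatrix (Fin.castLE h2) (Fin.castLE h2)).det
        else Ms (i - 1) a b) :
    (Ms n).det = 1 := by
  have hzero : ∀ i ≤ n, ∀ a : Fin n, i ≤ a.val → Ms i a a = 0 := by
    intro i
    induction i with
    | zero => intro _ a _; rw [h0, hdiag]
    | succ k ih =>
      intro hk a ha
      rw [hstep (k + 1) (by omega) hk, if_neg (by omega)]
      exact ih (by omega) a (by omega)
  have hcorner : ∀ i, ∀ hi : i ≤ n,
      ((Ms i).submatrix (Fin.castLE hi) (Fin.castLE hi)).det = 1 := by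
    intro i
    induction i with
    | zero => intro _; exact Matrix.det_fin_zero
    | succ k ih =>
      intro hk
      have hlast : Ms k (Fin.castLE hk (Fin.last k)) (Fin.castLE hk (Fin.last k)) = 0 :=
        hzero k (by omega) _ (by simp)
      have hminor : (((Ms k).submatrix (Fin.castLE hk) (Fin.castLE hk)).submatrix
          Fin.castSucc Fin.castSucc).det = 1 := ih (by omega)
      rw [det_eq_add_mul_det_of_eq_off_last ((Ms k).submatrix (Fin.castLE hk) (Fin.castLE hk)),
        hminor, Matrix.submatrix_apply, Matrix.submatrix_apply, hlast,
        hstep (k + 1) (by omega) hk, if_pos (by simp)]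
      · simp only [Nat.add_sub_cancel, sub_zero, mul_one]
        rw [add_left_comm, CharTwo.add_self_eq_zero, add_zero]
      · intro a b hab
        rw [Matrix.submatrix_apply, hstep (k + 1) (by omega) hk, if_neg]
        · rfl
        · simpa [Fin.ext_iff] using hab
  exact hcorner n le_rfl
end

section
/- Let M ∈ Z₂^{n×n} be a symmetric matrix. The following two conditions are equivalent: (i) there exists a diagonal matrix D ∈ Z₂^{n×n} such that in M + D all non-zero rows are equal; (ii) there do not exist three pairwise distinct indices i, j, k with M_{i,j} = M_{i,k} = 1 and M_{j,k} = 0, and there do not exist four pairwise distinct indices i, j, k, l with M_{i,j} = 1, M_{k,l} = 1 and M_{i,k} = M_{i,l} = M_{j,k} = M_{j,l} = 0. -/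
theorem ZMod.two_eq_zero_or_one (x : ZMod 2) : x = 0 ∨ x = 1 := by
  revert x
  decide

/-- If adjacency via off-diagonal ones of `M` has neither an induced path on three vertices nor an
induced pair of disjoint edges, then any two non-isolated vertices are adjacent. -/
theorem eq_one_of_forbidden_configurations {ι : Type*} {M : Matrix ι ι (ZMod 2)} (hsymm : M.IsSymm)
    (hpath : ¬ ∃ i j k : ι, i ≠ j ∧ i ≠ k ∧ j ≠ k ∧ M i j = 1 ∧ M i k = 1 ∧ M j k = 0)
    (hpair : ¬ ∃ i j k l : ι, i ≠ j ∧ i ≠ k ∧ i ≠ l ∧ j ≠ k ∧ j ≠ l ∧ k ≠ l ∧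
        M i j = 1 ∧ M k l = 1 ∧ M i k = 0 ∧ M i l = 0 ∧ M j k = 0 ∧ M j l = 0)
    {a b : ι} (hab : a ≠ b) (ha : ∃ c, c ≠ a ∧ M a c = 1) (hb : ∃ d, d ≠ b ∧ M b d = 1) :
    M a b = 1 := by
  have trans {i j k : ι} (hij : i ≠ j) (hik : i ≠ k) (hjk : j ≠ k) (h₁ : M i j = 1)
      (h₂ : M i k = 1) : M j k = 1 :=
    (ZMod.two_eq_zero_or_one _).resolve_left fun h ↦ hpath ⟨i, j, k, hij, hik, hjk, h₁, h₂, h⟩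
  have zero_of_ne {x : ZMod 2} (hx : x ≠ 1) : x = 0 := (ZMod.two_eq_zero_or_one x).resolve_right hx
  obtain ⟨c, hca, hac⟩ := ha
  obtain ⟨d, hdb, hbd⟩ := hb
  by_contra h
  have hca' : M c a = 1 := by rw [hsymm.apply, hac]
  have hdb' : M d b = 1 := by rw [hsymm.apply, hbd]
  have hcb : c ≠ b := by rintro rfl; exact h hac
  have hda : d ≠ a := by rintro rfl; exact h hdb'
  have hMcb : M c b ≠ 1 := fun h' ↦ h (trans hca hcb hab hca' h')
  have hMad : M a d ≠ 1 := fun h' ↦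
    h (trans hda hdb hab (by rw [hsymm.apply, h']) hdb')
  have hcd : c ≠ d := by rintro rfl; exact hMad hac
  have hMcd : M c d ≠ 1 := fun h' ↦ hMad (trans hca hcd hda.symm hca' h')
  exact hpair ⟨a, c, b, d, hca.symm, hab, hda.symm, hcb, hcd, hdb.symm, hac, hbd,
    zero_of_ne h, zero_of_ne hMad, zero_of_ne hMcb, zero_of_ne hMcd⟩

/-- Let `M ∈ Z₂^{n×n}` be symmetric. The following are equivalent:
(i) there is a diagonal matrix `D` such that in `M + D` all non-zero rows are equal;
(ii) there are no pairwise distinct `i, j, k` with `M i j = M i k = 1` and `M j k = 0`,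
and there are no pairwise distinct `i, j, k, l` with `M i j = 1`, `M k l = 1` and
`M i k = M i l = M j k = M j l = 0`. -/
theorem diag_change_rank_one_criterion (n : ℕ)
    (M : Matrix (Fin n) (Fin n) (ZMod 2)) (hsymm : M.IsSymm) :
    (∃ D : Matrix (Fin n) (Fin n) (ZMod 2), D.IsDiag ∧
      ∀ a b : Fin n, (M + D) a ≠ 0 → (M + D) b ≠ 0 → (M + D) a = (M + D) b) ↔
    ((¬ ∃ i j k : Fin n, i ≠ j ∧ i ≠ k ∧ j ≠ k ∧
        M i j = 1 ∧ M i k = 1 ∧ M j k = 0) ∧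
     (¬ ∃ i j k l : Fin n, i ≠ j ∧ i ≠ k ∧ i ≠ l ∧ j ≠ k ∧ j ≠ l ∧ k ≠ l ∧
        M i j = 1 ∧ M k l = 1 ∧
        M i k = 0 ∧ M i l = 0 ∧ M j k = 0 ∧ M j l = 0)) := by
  constructor
  · rintro ⟨D, hD, h⟩
    have off {i j : Fin n} (hij : i ≠ j) : (M + D) i j = M i j := by
      rw [Matrix.add_apply, hD hij, add_zero]
    have row_ne {i j : Fin n} (hij : i ≠ j) (hM : M i j = 1) : (M + D) i ≠ 0 := by
      intro h0
      have := congrFun h0 j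
      rw [off hij, hM] at this
      exact one_ne_zero this
    constructor
    · rintro ⟨i, j, k, hij, hik, hjk, h₁, h₂, h₃⟩
      have := congrFun (h i j (row_ne hij h₁)
        (row_ne hij.symm (by rw [hsymm.apply, h₁]))) k
      rw [off hik, off hjk, h₂, h₃] at this
      exact one_ne_zero this
    · rintro ⟨i, j, k, l, hij, -, hil, -, -, hkl, h₁, h₂, -, h₃, -, -⟩
      have := congrFun (h i k (row_ne hij h₁) (row_ne hkl h₂)) l
      rw [off hil, off hkl, h₂, h₃] at this
      exact zero_ne_one this
  · rintro ⟨hpath, hpair⟩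
    classical
    let v : Fin n → ZMod 2 := fun i ↦ if ∃ j, j ≠ i ∧ M i j = 1 then 1 else 0
    have hMv : M + Matrix.diagonal (fun i ↦ v i * v i - M i i) = Matrix.vecMulVec v v := by
      ext i j
      rw [Matrix.add_apply, Matrix.vecMulVec_apply]
      obtain rfl | hij := eq_or_ne i j
      · simp
      rw [Matrix.diagonal_apply_ne _ hij, add_zero]
      by_cases hi : ∃ c, c ≠ i ∧ M i c = 1
      · by_cases hj : ∃ d, d ≠ j ∧ M j d = 1
        · simp only [v, if_pos hi, if_pos hj, mul_one]
          exact eq_one_of_forbidden_configurations hsymm hpath hpair hij hi hj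
        · simp only [v, if_neg hj, mul_zero]
          exact (ZMod.two_eq_zero_or_one _).resolve_right fun h ↦
            hj ⟨i, hij, by rw [hsymm.apply, h]⟩
      · simp only [v, if_neg hi, zero_mul]
        exact (ZMod.two_eq_zero_or_one _).resolve_right fun h ↦ hi ⟨j, hij.symm, h⟩
    refine ⟨_, Matrix.isDiag_diagonal fun i ↦ v i * v i - M i i, ?_⟩
    rw [hMv]
    have row_eq {a : Fin n} (ha : Matrix.vecMulVec v v a ≠ 0) : Matrix.vecMulVec v v a = v := by
      obtain h | h := ZMod.two_eq_zero_or_one (v a)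
      · exact absurd (by ext j; simp [Matrix.vecMulVec_apply, h]) ha
      · ext j
        simp [Matrix.vecMulVec_apply, h]
    intro a b ha hb
    rw [row_eq ha, row_eq hb]
end

section
/- For every symmetric matrix A ∈ Z₂^{n×n} there exist natural numbers k and ℓ with 2k + ℓ ≤ n and an invertible matrix P ∈ Z₂^{n×n} such that Pᵀ·A·P is the block-diagonal matrix consisting of k consecutive 2×2 blocks [[0,1],[1,0]], followed by ℓ diagonal entries equal to 1, with all remaining entries equal to 0. Moreover, if all diagonal entries of A are zero, then k and ℓ can be chosen with ℓ = 0. -/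
open Matrix

/-- Two square matrices, possibly with different index types, are congruent if one is obtained
from the other by an invertible change of basis. -/
def Matrix.Congruent {R ι κ : Type*} [CommRing R] [Fintype ι] [Fintype κ] [DecidableEq ι]
    [DecidableEq κ] (A : Matrix ι ι R) (B : Matrix κ κ R) : Prop :=
  ∃ (P : Matrix ι κ R) (Q : Matrix κ ι R), P * Q = 1 ∧ Q * P = 1 ∧ Pᵀ * A * P = B

namespace Matrix.Congruent

variable {R ι κ ν : Type*} [CommRing R] [Fintype ι] [Fintype κ] [Fintype ν] [DecidableEq ι]
  [DecidableEq κ] [DecidableEq ν]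

theorem trans {A : Matrix ι ι R} {B : Matrix κ κ R} {C : Matrix ν ν R}
    (hAB : A.Congruent B) (hBC : B.Congruent C) : A.Congruent C := by
  obtain ⟨P, Q, hPQ, hQP, rfl⟩ := hAB
  obtain ⟨P', Q', hPQ', hQP', rfl⟩ := hBC
  refine ⟨P * P', Q' * Q, ?_, ?_, ?_⟩
  · rw [Matrix.mul_assoc, ← Matrix.mul_assoc P', hPQ', Matrix.one_mul, hPQ]
  · rw [Matrix.mul_assoc, ← Matrix.mul_assoc Q, hQP, Matrix.one_mul, hQP']
  · simp only [Matrix.transpose_mul, Matrix.mul_assoc]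

theorem submatrix_equiv (A : Matrix ι ι R) (e : κ ≃ ι) : A.Congruent (A.submatrix e e) := by
  refine ⟨(1 : Matrix ι ι R).submatrix id e, (1 : Matrix ι ι R).submatrix e id, ?_, ?_, ?_⟩
  · rw [Matrix.submatrix_mul_equiv, Matrix.one_mul, Matrix.submatrix_id_id]
  · rw [← Matrix.submatrix_mul _ _ _ _ _ Function.bijective_id, Matrix.one_mul,
      Matrix.submatrix_one_equiv]
  · ext i j
    simp [Matrix.mul_apply, Matrix.one_apply]

theorem fromBlocks_right (A : Matrix ν ν R) {B : Matrix ι ι R} {C : Matrix κ κ R}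
    (h : B.Congruent C) : (fromBlocks A 0 0 B).Congruent (fromBlocks A 0 0 C) := by
  obtain ⟨P, Q, hPQ, hQP, rfl⟩ := h
  refine ⟨fromBlocks 1 0 0 P, fromBlocks 1 0 0 Q, ?_, ?_, ?_⟩ <;>
    simp [Matrix.fromBlocks_multiply, Matrix.fromBlocks_transpose, hPQ, hQP]

/-- Symmetric block elimination. -/
theorem schur (A G : Matrix ν ν R) (B : Matrix ν ι R) (D : Matrix ι ι R)
    (hA : A.IsSymm) (hG : A * G = 1) :
    (fromBlocks A B Bᵀ D).Congruent (fromBlocks A 0 0 (D - Bᵀ * G * B)) := by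
  have hG' : G * A = 1 := mul_eq_one_comm.mp hG
  have hGs : Gᵀ = G := by
    have h : Gᵀ * A = 1 := by simpa [hA.eq] using congrArg transpose hG
    calc Gᵀ = Gᵀ * (A * G) := by rw [hG, Matrix.mul_one]
      _ = G := by rw [← Matrix.mul_assoc, h, Matrix.one_mul]
  refine ⟨fromBlocks 1 (-(G * B)) 0 1, fromBlocks 1 (G * B) 0 1, ?_, ?_, ?_⟩
  · simp [Matrix.fromBlocks_multiply]
  · simp [Matrix.fromBlocks_multiply]
  · have h1 : A * (G * B) = B := by rw [← Matrix.mul_assoc, hG, Matrix.one_mul]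
    have h2 : Bᵀ * G * A = Bᵀ := by rw [Matrix.mul_assoc, hG', Matrix.mul_one]
    simp [Matrix.fromBlocks_multiply, Matrix.fromBlocks_transpose, hGs, h1, h2,
      sub_eq_neg_add, Matrix.mul_assoc]

/-- An invertible principal submatrix of a symmetric matrix splits off as a direct summand. -/
theorem split_principal {A : Matrix ι ι R} (hA : A.IsSymm) {f : ν → ι}
    (hf : Function.Injective f) {G : Matrix ν ν R} (hG : A.submatrix f f * G = 1) :
    let g : {a // a ∉ Set.range f} → ι := Subtype.val
    A.Congruent (fromBlocks (A.submatrix f f) 0 0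
      (A.submatrix g g - (A.submatrix f g)ᵀ * G * A.submatrix f g)) := by
  classical
  intro g
  let e : ν ⊕ {a // a ∉ Set.range f} ≃ ι :=
    ((Equiv.ofInjective f hf).sumCongr (Equiv.refl _)).trans (Equiv.Set.sumCompl (Set.range f))
  have he : A.submatrix e e = fromBlocks (A.submatrix f f) (A.submatrix f g)
      (A.submatrix f g)ᵀ (A.submatrix g g) := by
    ext (i | i) (j | j)
    · rfl
    · rfl
    · exact hA.apply _ _
    · rfl
  refine (submatrix_equiv A e).trans ?_
  rw [he]
  exact schur _ _ _ _ (hA.submatrix f) hG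

end Matrix.Congruent

/-- The direct sum of hyperbolic planes indexed by `κ`, an identity form indexed by `ν`, and a zero
form indexed by `μ`. -/
def Matrix.hyperbolicSum (R κ ν μ : Type*) [CommRing R] [DecidableEq κ] [DecidableEq ν] :
    Matrix (κ × Fin 2 ⊕ (ν ⊕ μ)) (κ × Fin 2 ⊕ (ν ⊕ μ)) R :=
  fromBlocks (of fun p q => if p.1 = q.1 ∧ p.2 ≠ q.2 then 1 else 0) 0 0 (fromBlocks 1 0 0 0)

theorem Matrix.Congruent.one_hyperbolicSum (R κ ν μ : Type*) [CommRing R] [DecidableEq κ]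
    [DecidableEq ν] [DecidableEq μ] [Fintype κ] [Fintype ν] [Fintype μ] :
    (fromBlocks (1 : Matrix Unit Unit R) 0 0 (hyperbolicSum R κ ν μ)).Congruent
      (hyperbolicSum R κ (Unit ⊕ ν) μ) := by
  let e : κ × Fin 2 ⊕ ((Unit ⊕ ν) ⊕ μ) ≃ Unit ⊕ (κ × Fin 2 ⊕ (ν ⊕ μ)) :=
    { toFun := Sum.elim (Sum.inr ∘ Sum.inl) (Sum.elim (Sum.elim Sum.inl
        (Sum.inr ∘ Sum.inr ∘ Sum.inl)) (Sum.inr ∘ Sum.inr ∘ Sum.inr))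
      invFun := Sum.elim (Sum.inr ∘ Sum.inl ∘ Sum.inl) (Sum.elim Sum.inl
        (Sum.elim (Sum.inr ∘ Sum.inl ∘ Sum.inr) (Sum.inr ∘ Sum.inr)))
      left_inv := by rintro (_ | (_ | _) | _) <;> rfl
      right_inv := by rintro (_ | _ | _ | _) <;> rfl }
  convert submatrix_equiv _ e
  ext (i | (i | i) | i) (j | (j | j) | j) <;>
    simp [e, hyperbolicSum, Matrix.one_apply]

theorem Matrix.Congruent.plane_hyperbolicSum (R κ ν μ : Type*) [CommRing R] [DecidableEq κ]
    [DecidableEq ν] [DecidableEq μ] [Fintype κ] [Fintype ν] [Fintype μ] :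
    (fromBlocks (!![0, 1; 1, 0] : Matrix (Fin 2) (Fin 2) R) 0 0 (hyperbolicSum R κ ν μ)).Congruent
      (hyperbolicSum R (Unit ⊕ κ) ν μ) := by
  let e : (Unit ⊕ κ) × Fin 2 ⊕ (ν ⊕ μ) ≃ Fin 2 ⊕ (κ × Fin 2 ⊕ (ν ⊕ μ)) :=
    { toFun := Sum.elim (fun p => Sum.elim (fun _ => Sum.inl p.2)
        (fun a => Sum.inr (Sum.inl (a, p.2))) p.1) (Sum.inr ∘ Sum.inr)
      invFun := Sum.elim (fun t => Sum.inl (Sum.inl (), t))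
        (Sum.elim (fun p => Sum.inl (Sum.inr p.1, p.2)) Sum.inr)
      left_inv := by rintro (⟨_ | _, _⟩ | _) <;> rfl
      right_inv := by rintro (_ | _ | _) <;> rfl }
  convert submatrix_equiv _ e
  ext (⟨i | i, s⟩ | i) (⟨j | j, t⟩ | j)
  · fin_cases s <;> fin_cases t <;> simp [e, hyperbolicSum]
  all_goals simp [e, hyperbolicSum]

theorem Matrix.Congruent.hyperbolicSum_of_equiv (R : Type*) {κ ν κ' ν' : Type*} (μ : Type*)
    [CommRing R] [DecidableEq κ] [DecidableEq ν] [DecidableEq κ'] [DecidableEq ν'] [DecidableEq μ]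
    [Fintype κ] [Fintype ν] [Fintype κ'] [Fintype ν'] [Fintype μ] (f : κ' ≃ κ) (g : ν' ≃ ν) :
    (hyperbolicSum R κ ν μ).Congruent (hyperbolicSum R κ' ν' μ) := by
  let e : κ' × Fin 2 ⊕ (ν' ⊕ μ) ≃ κ × Fin 2 ⊕ (ν ⊕ μ) :=
    (f.prodCongr (Equiv.refl _)).sumCongr (g.sumCongr (Equiv.refl _))
  convert submatrix_equiv _ e
  ext (i | i | i) (j | j | j) <;> simp [e, hyperbolicSum, Matrix.one_apply]

/-- A symmetric matrix over `ZMod 2` is congruent to a sum of hyperbolic planes, an identity form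
and a zero form; the identity form is absent if the matrix has zero diagonal. -/
theorem Matrix.IsSymm.exists_congruent_hyperbolicSum {ι : Type*} [Fintype ι] [DecidableEq ι]
    {A : Matrix ι ι (ZMod 2)} (hA : A.IsSymm) :
    ∃ k ℓ m : ℕ, A.Congruent (hyperbolicSum (ZMod 2) (Fin k) (Fin ℓ) (Fin m)) ∧
      ((∀ i, A i i = 0) → ℓ = 0) := by
  have eq_one : ∀ x : ZMod 2, x ≠ 0 → x = 1 := by decide
  induction hN : Fintype.card ι using Nat.strong_induction_on generalizing ι with
  | _ N ih =>
  by_cases hdiag : ∀ i, A i i = 0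
  · by_cases hzero : A = 0
    · subst hzero
      let e : Fin 0 × Fin 2 ⊕ (Fin 0 ⊕ Fin N) ≃ ι :=
        (Equiv.emptySum _ _).trans ((Equiv.emptySum _ _).trans (Fintype.equivFinOfCardEq hN).symm)
      refine ⟨0, 0, N, ?_, fun _ => rfl⟩
      convert Congruent.submatrix_equiv _ e
      ext (i | i | i) (j | j | j)
      all_goals first | exact i.1.elim0 | exact i.elim0 | exact j.1.elim0 | exact j.elim0 | rfl
    · obtain ⟨i, j, hij⟩ : ∃ i j, A i j ≠ 0 := by
        by_contra! h
        exact hzero (Matrix.ext h)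
      have hne : i ≠ j := fun h => hij (h ▸ hdiag i)
      have hij := eq_one _ hij
      have hf : Function.Injective ![i, j] := by
        intro a b
        fin_cases a <;> fin_cases b <;> simp [hne, hne.symm]
      have hsub : A.submatrix ![i, j] ![i, j] = !![0, 1; 1, 0] := by
        ext a b
        fin_cases a <;> fin_cases b <;> simp [hdiag, hij, hA.apply i j]
      have hsq : (!![0, 1; 1, 0] : Matrix (Fin 2) (Fin 2) (ZMod 2)) * !![0, 1; 1, 0] = 1 := by
        decide
      have hsplit := Congruent.split_principal hA hf (G := !![0, 1; 1, 0]) (by rw [hsub, hsq])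
      rw [hsub] at hsplit
      have hlt : Fintype.card {a // a ∉ Set.range ![i, j]} < N :=
        hN ▸ Fintype.card_subtype_lt (x := i) (by simp)
      obtain ⟨k, ℓ, m, h, hℓ⟩ := ih _ hlt
        (A := A.submatrix Subtype.val Subtype.val -
          (A.submatrix ![i, j] Subtype.val)ᵀ * (!![0, 1; 1, 0] : Matrix (Fin 2) (Fin 2) (ZMod 2)) *
            A.submatrix ![i, j] Subtype.val)
        (by
          refine (hA.submatrix _).sub ?_
          rw [Matrix.IsSymm, transpose_mul, transpose_mul, transpose_transpose, Matrix.mul_assoc]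
          congr 2
          decide) rfl
      refine ⟨k + 1, ℓ, m, (hsplit.trans (h.fromBlocks_right _)).trans
        ((Congruent.plane_hyperbolicSum _ _ _ _).trans (Congruent.hyperbolicSum_of_equiv _ _
          (finSumFinEquiv.symm.trans ((Equiv.sumComm _ _).trans
            (finOneEquiv.sumCongr (Equiv.refl _)))) (Equiv.refl _))), fun _ => hℓ fun a => ?_⟩
      simp only [Matrix.sub_apply, Matrix.mul_apply, Fin.sum_univ_two, Matrix.transpose_apply,
        Matrix.submatrix_apply]
      simp [hdiag, mul_comm, CharTwo.add_self_eq_zero]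
  · obtain ⟨i, hi⟩ := not_forall.mp hdiag
    have hi := eq_one _ hi
    have hsub : A.submatrix (fun _ : Unit => i) (fun _ : Unit => i) = 1 := by
      ext
      simp [hi]
    have hsplit := Congruent.split_principal hA
      (Function.injective_of_subsingleton fun _ : Unit => i) (G := 1)
      (by rw [hsub, Matrix.one_mul])
    rw [hsub] at hsplit
    have hlt : Fintype.card {a // a ∉ Set.range fun _ : Unit => i} < N :=
      hN ▸ Fintype.card_subtype_lt (x := i) (by simp)
    obtain ⟨k, ℓ, m, h, -⟩ := ih _ hlt
      (A := A.submatrix Subtype.val Subtype.val -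
        (A.submatrix (fun _ : Unit => i) Subtype.val)ᵀ * (1 : Matrix Unit Unit (ZMod 2)) *
          A.submatrix (fun _ : Unit => i) Subtype.val)
      (by
        refine (hA.submatrix _).sub ?_
        rw [Matrix.mul_one, Matrix.IsSymm, transpose_mul, transpose_transpose]) rfl
    exact ⟨k, ℓ + 1, m, (hsplit.trans (h.fromBlocks_right _)).trans
      ((Congruent.one_hyperbolicSum _ _ _ _).trans (Congruent.hyperbolicSum_of_equiv _ _
        (Equiv.refl _) (finSumFinEquiv.symm.trans ((Equiv.sumComm _ _).trans
          (finOneEquiv.sumCongr (Equiv.refl _)))))), fun h => absurd h hdiag⟩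

theorem Matrix.hyperbolicSum_submatrix_fin (R : Type*) [CommRing R] (k ℓ m n : ℕ)
    (hn : 2 * k + ℓ + m = n) :
    ∃ e : Fin n ≃ Fin k × Fin 2 ⊕ (Fin ℓ ⊕ Fin m),
      (hyperbolicSum R (Fin k) (Fin ℓ) (Fin m)).submatrix e e = Matrix.of fun i j : Fin n =>
        if i.val < 2 * k ∧ j.val < 2 * k ∧ i.val / 2 = j.val / 2 ∧ i ≠ j then 1
        else if i = j ∧ 2 * k ≤ i.val ∧ i.val < 2 * k + ℓ then 1 else 0 := by
  let e : Fin k × Fin 2 ⊕ (Fin ℓ ⊕ Fin m) ≃ Fin n :=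
    ((finProdFinEquiv.sumCongr finSumFinEquiv).trans finSumFinEquiv).trans (finCongr (by omega))
  refine ⟨e.symm, ?_⟩
  ext i j
  obtain ⟨i, rfl⟩ := e.surjective i
  obtain ⟨j, rfl⟩ := e.surjective j
  rcases i with ⟨i, s⟩ | i | i <;> rcases j with ⟨j, t⟩ | j | j <;>
    simp [e, hyperbolicSum, Matrix.one_apply, Fin.ext_iff] <;> grind

/-- For every symmetric matrix `A ∈ Z₂^{n×n}` there exist `k, ℓ` with
`2k + ℓ ≤ n` and an invertible matrix `P` such that `Pᵀ · A · P` is the block-diagonal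
matrix consisting of `k` consecutive `2×2` blocks `[[0,1],[1,0]]`, followed by `ℓ`
diagonal entries equal to `1`, all remaining entries being `0`.  Moreover, if all
diagonal entries of `A` are zero, then `k, ℓ` can be chosen with `ℓ = 0`. -/
theorem symm_bilinear_form_classification (n : ℕ)
    (A : Matrix (Fin n) (Fin n) (ZMod 2)) (hA : A.IsSymm) :
    ∃ (k ℓ : ℕ) (P : Matrix (Fin n) (Fin n) (ZMod 2)),
      2 * k + ℓ ≤ n ∧ IsUnit P.det ∧
      (Pᵀ * A * P = Matrix.of fun i j : Fin n =>
        if i.val < 2 * k ∧ j.val < 2 * k ∧ i.val / 2 = j.val / 2 ∧ i ≠ j then 1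
        else if i = j ∧ 2 * k ≤ i.val ∧ i.val < 2 * k + ℓ then 1 else 0) ∧
      ((∀ i, A i i = 0) → ℓ = 0) := by
  obtain ⟨k, ℓ, m, h, hdiag⟩ := hA.exists_congruent_hyperbolicSum
  have hn : 2 * k + ℓ + m = n := by
    obtain ⟨P, Q, hPQ, hQP, -⟩ := h
    have := Matrix.square_of_invertible P Q hPQ hQP
    simp at this
    omega
  obtain ⟨e, he⟩ := hyperbolicSum_submatrix_fin (ZMod 2) k ℓ m n hn
  obtain ⟨P, Q, hPQ, -, hP⟩ := h.trans (Congruent.submatrix_equiv _ e)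
  exact ⟨k, ℓ, P, by omega, isUnit_det_of_right_inverse hPQ, hP.trans he, hdiag⟩
end
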